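/- Single-word mixed-commutator bound: let X and Y be d × d complex matrices, M := max{‖X‖_∞, ‖Y‖_∞}, and let r ≥ 2 and (Z_1,…,Z_r) ∈ {X,Y}^r be any word in the letters X and Y. Then ‖L_r(Z_1,…,Z_r)‖_F ≤ r · 2^{r−1} · M^{r−1} · ‖X+Y‖_F. -/

import Mathlib

/-- The operator (spectral) norm of a complex matrix. -/
noncomputable def opNorm {ι : Type*} [Fintype ι] [DecidableEq ι] (M : Matrix ι ι ℂ) : ℝ :=
  ‖Matrix.toEuclideanCLM (𝕜 := ℂ) M‖

/-- The normalized Frobenius norm `‖M‖_F := (d⁻¹ Tr(Mᴴ M))^{1/2}` of a `d × d` matrix. -/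
noncomputable def frobNorm {ι : Type*} [Fintype ι] (M : Matrix ι ι ℂ) : ℝ :=
  Real.sqrt ((Matrix.trace (M.conjTranspose * M)).re / Fintype.card ι)

/-- The left-normed commutator `L_r(Z₁,…,Z_r) = [Z₁,[Z₂,…,[Z_{r-1},Z_r]…]]` of a list of
square matrices (by convention `0` for the empty list). -/
noncomputable def Lword {ι : Type*} [Fintype ι] : List (Matrix ι ι ℂ) → Matrix ι ι ℂ
  | [] => 0
  | [Z] => Z
  | Z :: W :: rest => Z * Lword (W :: rest) - Lword (W :: rest) * Z

namespace Matrix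

variable {ι : Type*} [Fintype ι]

theorem trace_conjTranspose_mul_self_re (A : Matrix ι ι ℂ) :
    (trace (Aᴴ * A)).re = ∑ j, ‖WithLp.toLp 2 (A.col j)‖ ^ 2 := by
  simp only [trace, diag_apply, mul_apply, conjTranspose_apply, Complex.re_sum,
    EuclideanSpace.norm_sq_eq, col_apply]
  refine Finset.sum_congr rfl fun j _ => Finset.sum_congr rfl fun i _ => ?_
  rw [Complex.star_def, Complex.conj_mul', ← Complex.ofReal_pow, Complex.ofReal_re]

section FrobeniusNorm

attribute [local instance] Matrix.frobeniusNormedAddCommGroup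

theorem frobNorm_eq_norm_div_sqrt (A : Matrix ι ι ℂ) :
    frobNorm A = ‖A‖ / Real.sqrt (Fintype.card ι) := by
  rw [frobNorm, trace_conjTranspose_mul_self_re, Real.sqrt_div' _ (Nat.cast_nonneg _),
    frobenius_norm_def, ← Real.sqrt_eq_rpow, Finset.sum_comm]
  simp [EuclideanSpace.norm_sq_eq]

theorem frobNorm_sub_le (A B : Matrix ι ι ℂ) : frobNorm (A - B) ≤ frobNorm A + frobNorm B := by
  simp only [frobNorm_eq_norm_div_sqrt, ← add_div]
  gcongr
  exact norm_sub_le A B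

theorem frobNorm_conjTranspose (A : Matrix ι ι ℂ) : frobNorm Aᴴ = frobNorm A := by
  simp only [frobNorm_eq_norm_div_sqrt, frobenius_norm_conjTranspose]

theorem frobNorm_zero : frobNorm (0 : Matrix ι ι ℂ) = 0 := by
  simp [frobNorm]

theorem frobNorm_nonneg (A : Matrix ι ι ℂ) : 0 ≤ frobNorm A := Real.sqrt_nonneg _

end FrobeniusNorm

variable [DecidableEq ι]

theorem opNorm_nonneg (A : Matrix ι ι ℂ) : 0 ≤ opNorm A := norm_nonneg _

theorem opNorm_conjTranspose (A : Matrix ι ι ℂ) : opNorm Aᴴ = opNorm A :=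
  l2_opNorm_conjTranspose A

theorem frobNorm_mul_le (A B : Matrix ι ι ℂ) : frobNorm (A * B) ≤ opNorm A * frobNorm B := by
  rw [frobNorm, frobNorm, ← Real.sqrt_sq (opNorm_nonneg A), ← Real.sqrt_mul (sq_nonneg _),
    trace_conjTranspose_mul_self_re, trace_conjTranspose_mul_self_re, mul_div_assoc',
    Finset.mul_sum]
  gcongr with j
  rw [← mul_pow]
  gcongr
  exact l2_opNorm_mulVec A (WithLp.toLp 2 (B.col j))

theorem frobNorm_mul_le' (A B : Matrix ι ι ℂ) : frobNorm (A * B) ≤ opNorm B * frobNorm A := by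
  rw [← frobNorm_conjTranspose, conjTranspose_mul, ← opNorm_conjTranspose B,
    ← frobNorm_conjTranspose A]
  exact frobNorm_mul_le _ _

theorem frobNorm_commutator_le {A : Matrix ι ι ℂ} {m : ℝ} (hA : opNorm A ≤ m)
    (B : Matrix ι ι ℂ) : frobNorm (A * B - B * A) ≤ 2 * m * frobNorm B := by
  have h := mul_le_mul_of_nonneg_right hA (frobNorm_nonneg B)
  linarith [frobNorm_sub_le (A * B) (B * A), frobNorm_mul_le A B, frobNorm_mul_le' B A]

/-- If `A` and `B` are letters of the word, their commutator vanishes or equals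
`[A, X + Y]`. -/
theorem commutator_letters_eq {X Y A B : Matrix ι ι ℂ} (hA : A = X ∨ A = Y)
    (hB : B = X ∨ B = Y) :
    A * B - B * A = 0 ∨ A * B - B * A = A * (X + Y) - (X + Y) * A := by
  rcases hA with rfl | rfl <;> rcases hB with rfl | rfl
  · exact .inl (sub_self _)
  · exact .inr (by noncomm_ring)
  · exact .inr (by noncomm_ring)
  · exact .inl (sub_self _)

theorem frobNorm_Lword_le {X Y : Matrix ι ι ℂ} :
    ∀ (A B : Matrix ι ι ℂ) (l : List (Matrix ι ι ℂ)), (∀ C ∈ A :: B :: l, C = X ∨ C = Y) →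
      frobNorm (Lword (A :: B :: l)) ≤
        (2 * max (opNorm X) (opNorm Y)) ^ (l.length + 1) * frobNorm (X + Y)
  | A, B, l, h => by
    have hA : opNorm A ≤ max (opNorm X) (opNorm Y) := by
      rcases h A (by simp) with rfl | rfl <;> simp
    have hm : 0 ≤ 2 * max (opNorm X) (opNorm Y) :=
      mul_nonneg zero_le_two ((opNorm_nonneg A).trans hA)
    rw [Lword]
    cases l with
    | nil =>
      rw [Lword, List.length_nil, zero_add, pow_one]
      rcases commutator_letters_eq (h A (by simp)) (h B (by simp)) with h0 | h1
      · rw [h0, frobNorm_zero]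
        exact mul_nonneg hm (frobNorm_nonneg _)
      · rw [h1]
        exact frobNorm_commutator_le hA _
    | cons C l =>
      refine (frobNorm_commutator_le hA _).trans ?_
      rw [List.length_cons, pow_succ', mul_assoc (2 * max (opNorm X) (opNorm Y)) (_ ^ _)]
      exact mul_le_mul_of_nonneg_left
        (frobNorm_Lword_le B C l fun D hD => h D (List.mem_cons_of_mem _ hD)) hm

end Matrix


/-- **Single-word mixed-commutator bound.** For a word `(Z₁,…,Z_r) ∈ {X,Y}^r` of length `r ≥ 2`,
`‖L_r(Z₁,…,Z_r)‖_F ≤ r 2^{r-1} M^{r-1} ‖X+Y‖_F` where `M = max{‖X‖_∞, ‖Y‖_∞}`. -/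
theorem word_commutator_bound {d r : ℕ} (hr : 2 ≤ r)
    (X Y : Matrix (Fin d) (Fin d) ℂ) (Z : Fin r → Matrix (Fin d) (Fin d) ℂ)
    (hZ : ∀ i, Z i = X ∨ Z i = Y) :
    frobNorm (Lword (List.ofFn Z)) ≤
      (r : ℝ) * 2 ^ (r - 1) * max (opNorm X) (opNorm Y) ^ (r - 1) * frobNorm (X + Y) := by
  obtain ⟨n, rfl⟩ : ∃ n, r = n + 2 := ⟨r - 2, by omega⟩
  have hmem : ∀ C ∈ List.ofFn Z, C = X ∨ C = Y := by
    intro C hC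
    obtain ⟨i, rfl⟩ := (List.mem_ofFn' Z C).1 hC
    exact hZ i
  have hm : 0 ≤ max (opNorm X) (opNorm Y) := (Matrix.opNorm_nonneg X).trans (le_max_left _ _)
  have hF := Matrix.frobNorm_nonneg (X + Y)
  rw [List.ofFn_succ, List.ofFn_succ] at hmem ⊢
  refine (Matrix.frobNorm_Lword_le _ _ _ hmem).trans ?_
  rw [List.length_ofFn, mul_pow, mul_assoc, mul_assoc, mul_assoc]
  refine le_mul_of_one_le_left (by positivity) ?_
  exact_mod_cast (by omega : 1 ≤ n + 2)
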